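/- Let n ≥ 1 and r ≥ n. The set of polynomials g ∈ ℚ[t_1, …, t_r] that are homogeneous of total degree n, quasi-symmetric, and satisfy the q-th cancellation relation for every q with 1 ≤ q ≤ r−1 is a ℚ-vector subspace of dimension c_{n−1}, the (n−1)-th Fibonacci number. -/

import Mathlib

open scoped Classical
open MvPolynomial

/-- The quasi-symmetric monomial `M_ω` in `r` variables associated to a composition `ω`. -/
noncomputable def qsymMonomial (r : ℕ) (ω : List ℕ+) : MvPolynomial (Fin r) ℚ :=
  ∑ l ∈ Finset.univ.filter (fun l : Fin ω.length → Fin r => StrictMono l),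
    ∏ i : Fin ω.length, X (l i) ^ ((ω.get i : ℕ))

/-- `g` satisfies the `q`-th cancellation relation (here `q` is `0`-indexed,
`0 ≤ q ≤ r-2`): substituting `s` for `t_{q}` and `-s` for `t_{q+1}` gives the same
polynomial as substituting `0` for both. -/
def CancelRel {r : ℕ} (g : MvPolynomial (Fin r) ℚ) (q : ℕ) (hq : q + 1 < r) : Prop :=
  aeval (fun j : Fin r =>
      if (j : ℕ) = q then X (⟨q, by omega⟩ : Fin r)
      else if (j : ℕ) = q + 1 then -X (⟨q, by omega⟩ : Fin r)
      else X j) g =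
  aeval (fun j : Fin r =>
      if (j : ℕ) = q then (0 : MvPolynomial (Fin r) ℚ)
      else if (j : ℕ) = q + 1 then 0
      else X j) g

namespace PeakAlg

/-! Odd compositions -/

def bump : List ℕ → List ℕ
  | [] => []
  | k :: l => (k + 2) :: l

def oc : ℕ → Finset (List ℕ)
  | 0 => ∅
  | 1 => {[1]}
  | (n + 2) => (oc (n + 1)).image (List.cons 1) ∪ (oc n).image bump

lemma bump_inj : Function.Injective bump := by
  intro a b h
  cases a <;> cases b <;> simp_all [bump]

lemma mem_oc : ∀ (n : ℕ) (w : List ℕ), w ∈ oc n ↔ w ≠ [] ∧ (∀ k ∈ w, Odd k) ∧ w.sum = n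
  | 0, w => by
    cases w with
    | nil => simp [oc]
    | cons k l =>
      simp only [oc, Finset.notMem_empty, false_iff]
      rintro ⟨-, h, hs⟩
      have := (h k (by simp)).pos
      simp at hs; omega
  | 1, w => by
    cases w with
    | nil => simp [oc]
    | cons k l =>
      simp only [oc, Finset.mem_singleton]
      constructor
      · intro h; rw [h]; simp
      · rintro ⟨-, h, hs⟩
        have h1 := (h k (by simp)).pos
        cases l with
        | nil => simp at hs; simp [hs]
        | cons m l =>
          have h2 := (h m (by simp)).pos
          simp at hs; omega
  | (n + 2), w => by
    simp only [oc, Finset.mem_union, Finset.mem_image]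
    constructor
    · rintro (⟨v, hv, rfl⟩ | ⟨v, hv, rfl⟩)
      · rw [mem_oc] at hv
        refine ⟨by simp, ?_, by simp [hv.2.2]; omega⟩
        intro k hk
        rcases List.mem_cons.1 hk with rfl | hk
        · exact odd_one
        · exact hv.2.1 k hk
      · rw [mem_oc] at hv
        cases v with
        | nil => simp at hv
        | cons m l =>
          refine ⟨by simp [bump], ?_, ?_⟩
          · intro k hk
            rcases List.mem_cons.1 hk with rfl | hk
            · have := hv.2.1 m (by simp)
              exact this.add_even (by decide)
            · exact hv.2.1 k (by simp [hk])
          · have := hv.2.2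
            simp [bump] at *; omega
    · rintro ⟨h0, h, hs⟩
      cases w with
      | nil => simp at h0
      | cons k l =>
        have hk := h k (by simp)
        by_cases h1 : k = 1
        · left
          subst h1
          refine ⟨l, ?_, rfl⟩
          rw [mem_oc]
          simp at hs
          refine ⟨?_, fun m hm => h m (by simp [hm]), by omega⟩
          rintro rfl
          simp at hs
        · right
          obtain ⟨m, rfl⟩ := hk
          obtain ⟨p, rfl⟩ : ∃ p, m = p + 1 := ⟨m - 1, by omega⟩
          refine ⟨(2 * p + 1) :: l, ?_, by simp [bump]; omega⟩
          rw [mem_oc]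
          simp at hs
          refine ⟨by simp, ?_, by simp; omega⟩
          intro k hk
          rcases List.mem_cons.1 hk with rfl | hk
          · exact ⟨p, rfl⟩
          · exact h k (by simp [hk])

lemma card_oc : ∀ n, (oc n).card = Nat.fib n
  | 0 => by simp [oc]
  | 1 => by simp [oc]
  | (n + 2) => by
    rw [oc, Finset.card_union_of_disjoint, Finset.card_image_of_injective,
      Finset.card_image_of_injective _ bump_inj, card_oc, card_oc, Nat.fib_add_two, add_comm]
    · exact List.cons_injective
    · rw [Finset.disjoint_left]
      intro w h1 h2
      rw [Finset.mem_image] at h1 h2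
      obtain ⟨v, hv, rfl⟩ := h1
      obtain ⟨u, hu, h⟩ := h2
      rw [mem_oc] at hu
      cases u with
      | nil => simp at hu
      | cons k l =>
        simp [bump] at h

/-! The algebra -/

abbrev A := MonoidAlgebra ℚ (FreeMonoid ℕ)

noncomputable def gen (k : ℕ) : A := MonoidAlgebra.single (FreeMonoid.of k) 1

noncomputable def H (k : ℕ) : A :=
  if k = 0 then 1 else if Odd k then gen k else
    (-(1 / 2) : ℚ) • ∑ j : Fin (k - 1), (-1 : A) ^ ((j : ℕ) + 1) * (H (k - (j + 1)) * H (j + 1))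
termination_by k
decreasing_by
  · omega
  · omega

lemma H_zero : H 0 = 1 := by rw [H]; simp

lemma H_odd {k : ℕ} (h : Odd k) : H k = gen k := by
  rw [H, if_neg h.pos.ne', if_pos h]

lemma sum_split {M : Type*} [AddCommMonoid M] (k : ℕ) (hk : 1 ≤ k) (F : ℕ → ℕ → M) :
    ∑ p ∈ Finset.HasAntidiagonal.antidiagonal k, F p.1 p.2 =
      F k 0 + F 0 k + ∑ j : Fin (k - 1), F (k - (j + 1)) (j + 1) := by
  obtain ⟨m, rfl⟩ : ∃ m, k = m + 1 := ⟨k - 1, by omega⟩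
  rw [← Finset.Nat.sum_antidiagonal_swap, Finset.Nat.sum_antidiagonal_eq_sum_range_succ_mk]
  simp only [Prod.swap_prod_mk, Nat.succ_eq_add_one]
  rw [Finset.sum_range_succ', Finset.sum_range_succ, Fin.sum_univ_eq_sum_range (fun j => F (m + 1 - (j + 1)) (j + 1))]
  simp
  abel

lemma H_even {k : ℕ} (h0 : 1 ≤ k) (h : Even k) :
    ∑ p ∈ Finset.HasAntidiagonal.antidiagonal k, (-1 : A) ^ p.2 * (H p.1 * H p.2) = 0 := by
  rw [sum_split k h0 (fun i j => (-1 : A) ^ j * (H i * H j))]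
  simp only [H_zero, h.neg_one_pow]
  have : H k = (-(1 / 2) : ℚ) • ∑ j : Fin (k - 1), (-1 : A) ^ ((j : ℕ) + 1) * (H (k - (j + 1)) * H (j + 1)) := by
    conv_lhs => rw [H]
    rw [if_neg (by omega), if_neg (by simpa using h)]
  generalize (∑ j : Fin (k - 1), (-1 : A) ^ ((j : ℕ) + 1) * (H (k - (j + 1)) * H (j + 1))) = Z at *
  rw [this]
  simp
  module

open PowerSeries in
lemma H_rel (k : ℕ) (hk : 1 ≤ k) :
    ∑ p ∈ Finset.HasAntidiagonal.antidiagonal k, (-1 : A) ^ p.2 * (H p.1 * H p.2) = 0 := by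
  set P : PowerSeries A := PowerSeries.mk H with hP
  set P' : PowerSeries A := PowerSeries.mk (fun k => (-1 : A) ^ k * H k) with hP'
  set O : PowerSeries A := P * P' - 1 with hO
  have comm : ∀ (k : ℕ) (x : A), x * (-1 : A) ^ k = (-1 : A) ^ k * x := by
    intro k x
    rcases neg_one_pow_eq_or A k with h | h <;> simp [h]
  have hc : ∀ k, 1 ≤ k → PowerSeries.coeff k O =
      ∑ p ∈ Finset.HasAntidiagonal.antidiagonal k, (-1 : A) ^ p.2 * (H p.1 * H p.2) := by
    intro k hk
    rw [hO, map_sub, PowerSeries.coeff_mul, PowerSeries.coeff_one, if_neg (by omega), sub_zero]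
    refine Finset.sum_congr rfl fun p _ => ?_
    rw [hP, hP', PowerSeries.coeff_mk, PowerSeries.coeff_mk, ← mul_assoc, comm, mul_assoc]
  have h0 : PowerSeries.coeff 0 O = 0 := by
    simp [hO, hP, hP', H_zero]
  have h2 : P' * P = 1 - O := by
    ext1 k
    rcases Nat.eq_zero_or_pos k with rfl | hk
    · rw [map_sub, h0]
      simp [hP, hP', H_zero]
    · rw [map_sub, hc k hk, PowerSeries.coeff_mul, PowerSeries.coeff_one, if_neg (by omega), zero_sub]
      have : ∀ p ∈ Finset.HasAntidiagonal.antidiagonal k, PowerSeries.coeff p.1 P' * PowerSeries.coeff p.2 P =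
          (-1 : A) ^ k * ((-1 : A) ^ p.2 * (H p.1 * H p.2)) := by
        intro p hp
        rw [← Finset.HasAntidiagonal.mem_antidiagonal.1 hp, hP, hP', PowerSeries.coeff_mk, PowerSeries.coeff_mk,
          ← mul_assoc, ← pow_add, add_assoc, pow_add _ p.1, ← two_mul, pow_mul]
        simp [mul_assoc]
      rw [Finset.sum_congr rfl this, ← Finset.mul_sum]
      rcases Nat.even_or_odd k with h | h
      · rw [H_even hk h]; simp
      · rw [h.neg_one_pow]; simp
  have h3 : O * P + P * O = 0 := by
    have : (P * P') * P = P * (P' * P) := mul_assoc _ _ _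
    rw [h2, show P * P' = O + 1 by rw [hO]; abel] at this
    rw [add_mul, mul_sub, one_mul, mul_one] at this
    have h4 : O * P + P * O = (O * P + P) - (P - P * O) := by abel
    rw [h4, this, sub_self]
  have h5 : ∀ k, PowerSeries.coeff k O = 0 := by
    intro k
    induction k using Nat.strong_induction_on with
    | _ k ih =>
      have := congrArg (PowerSeries.coeff k) h3
      rw [map_add, PowerSeries.coeff_mul, PowerSeries.coeff_mul, map_zero,
        Finset.sum_eq_single (k, 0), Finset.sum_eq_single (0, k)] at this
      · simp only [hP, PowerSeries.coeff_mk, H_zero, mul_one, one_mul] at this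
        have h6 : (2 : ℚ) • PowerSeries.coeff k O = 0 := by rw [two_smul]; exact this
        exact (smul_eq_zero.1 h6).resolve_left (by norm_num)
      · rintro ⟨i, j⟩ hp hne
        have := Finset.HasAntidiagonal.mem_antidiagonal.1 hp
        simp only at this
        rw [ih j, mul_zero]
        rcases Nat.eq_zero_or_pos i with rfl | h
        · exact absurd (by simp at this; simp [this]) hne
        · omega
      · simp
      · rintro ⟨i, j⟩ hp hne
        have := Finset.HasAntidiagonal.mem_antidiagonal.1 hp
        simp only at this
        rw [ih i, zero_mul]
        rcases Nat.eq_zero_or_pos j with rfl | h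
        · exact absurd (by simp at this; simp [this]) hne
        · omega
      · simp
  rw [← hc k hk, h5]

lemma prod_gen (w : List ℕ) : (w.map gen).prod = MonoidAlgebra.single (FreeMonoid.ofList w) 1 := by
  induction w with
  | nil => rfl
  | cons k l ih =>
    rw [List.map_cons, List.prod_cons, ih, gen, MonoidAlgebra.single_mul_single, mul_one]
    rfl

lemma exists_functional (S : Finset (List ℕ)) (y : S → ℚ) :
    ∃ φ : A →ₗ[ℚ] ℚ, ∀ w : S, φ ((w.1.map gen).prod) = y w := by
  refine ⟨Finsupp.lsum ℚ (fun m : FreeMonoid ℕ => (if h : FreeMonoid.toList m ∈ S then y ⟨_, h⟩ else 0) • (LinearMap.id : ℚ →ₗ[ℚ] ℚ)) ∘ₗ (MonoidAlgebra.coeffLinearEquiv ℚ).toLinearMap, ?_⟩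
  intro w
  rw [prod_gen]
  simp

end PeakAlg
namespace PeakAlg
variable {r : ℕ}

def comp (e : Fin r →₀ ℕ) : List ℕ := (List.ofFn e).filter (fun k => decide (k ≠ 0))

noncomputable def upd (f : Fin r →₀ ℕ) (q : ℕ) (hq : q + 1 < r) (i j : ℕ) : Fin r →₀ ℕ :=
  Finsupp.equivFunOnFinite.symm
    (fun x => if (x : ℕ) = q then i else if (x : ℕ) = q + 1 then j else f x)

lemma upd_apply (f : Fin r →₀ ℕ) (q : ℕ) (hq : q + 1 < r) (i j : ℕ) (x : Fin r) :
    upd f q hq i j x = if (x : ℕ) = q then i else if (x : ℕ) = q + 1 then j else f x := rfl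

lemma ofFn_upd (f : Fin r →₀ ℕ) (q : ℕ) (hq : q + 1 < r) (i j : ℕ) :
    List.ofFn (upd f q hq i j) =
      (List.ofFn f).take q ++ i :: j :: (List.ofFn f).drop (q + 2) := by
  apply List.ext_getElem
  · simp; omega
  · intro m h1 h2
    simp only [List.length_ofFn] at h1
    rw [List.getElem_ofFn, upd_apply]
    simp only [List.getElem_append, List.getElem_cons, List.length_take, List.length_ofFn,
      List.getElem_take, List.getElem_ofFn, List.getElem_drop]
    have : min q r = q := by omega
    simp only [this]
    split_ifs <;> first | rfl | omega | (congr 1; ext; simp; omega)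

lemma sum_comp (e : Fin r →₀ ℕ) : (comp e).sum = e.degree := by
  rw [Finsupp.degree_eq_sum, ← List.sum_ofFn, comp]
  induction List.ofFn e with
  | nil => rfl
  | cons k l ih =>
    by_cases h : k = 0 <;> simp [h] at * <;> omega

lemma comp_pos (e : Fin r →₀ ℕ) : ∀ k ∈ comp e, 0 < k := by
  intro k hk
  simp [comp] at hk
  omega

noncomputable def pad (r : ℕ) (w : List ℕ) : Fin r →₀ ℕ :=
  Finsupp.equivFunOnFinite.symm (fun x => w.getD x 0)

lemma ofFn_pad (w : List ℕ) (h : w.length ≤ r) :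
    List.ofFn (pad r w) = w ++ List.replicate (r - w.length) 0 := by
  apply List.ext_getElem
  · simp; omega
  · intro m h1 h2
    simp only [List.length_ofFn] at h1
    rw [List.getElem_ofFn]
    simp only [pad, Finsupp.equivFunOnFinite_symm_apply_apply, List.getElem_append, List.getElem_replicate]
    split_ifs with h3
    · simp [h3]
    · simp [List.getElem?_eq_none (not_lt.1 h3)]

lemma comp_pad (w : List ℕ) (h : w.length ≤ r) :
    comp (pad r w) = w.filter (fun k => decide (k ≠ 0)) := by
  rw [comp, ofFn_pad w h, List.filter_append]
  simp

lemma filter_pos (w : List ℕ) (h : ∀ k ∈ w, 0 < k) :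
    w.filter (fun k => decide (k ≠ 0)) = w := by
  rw [List.filter_eq_self]
  intro a ha
  have := h a ha
  simp; omega

/-- the exponent vector of `l, w`. -/
noncomputable def expo (ω : List ℕ+) (l : Fin ω.length → Fin r) : Fin r →₀ ℕ :=
  ∑ i, Finsupp.single (l i) (ω.get i : ℕ)

lemma qsym_eq (ω : List ℕ+) : qsymMonomial r ω =
    ∑ l ∈ Finset.univ.filter (fun l : Fin ω.length → Fin r => StrictMono l),
      monomial (expo ω l) 1 := by
  rw [qsymMonomial]
  refine Finset.sum_congr rfl fun l _ => ?_
  rw [expo, MvPolynomial.monomial_sum_one]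
  refine Finset.prod_congr rfl fun i _ => ?_
  rw [MvPolynomial.X_pow_eq_monomial]

/-- ordered list of the support -/
def sup (e : Fin r →₀ ℕ) : List (Fin r) := (List.finRange r).filter (fun x => decide (e x ≠ 0))

lemma comp_eq (e : Fin r →₀ ℕ) : comp e = (sup e).map e := by
  rw [comp, sup, List.ofFn_eq_map, List.filter_map]
  rfl

lemma expo_apply (ω : List ℕ+) (l : Fin ω.length → Fin r) (hl : StrictMono l) (i) :
    expo ω l (l i) = ω.get i := by
  rw [expo, Finsupp.finsetSum_apply, Finset.sum_eq_single i]
  · simp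
  · intro j _ hj
    rw [Finsupp.single_apply, if_neg]
    exact fun h => hj (hl.injective h)
  · simp

lemma expo_ne (ω : List ℕ+) (l : Fin ω.length → Fin r) (x) :
    expo ω l x ≠ 0 ↔ ∃ i, l i = x := by
  rw [expo, Finsupp.finsetSum_apply]
  simp [Finsupp.single_apply]

lemma sup_sorted (e : Fin r →₀ ℕ) : (sup e).Pairwise (· < ·) :=
  (List.pairwise_lt_finRange r).filter _

lemma sup_expo (ω : List ℕ+) (l : Fin ω.length → Fin r) (hl : StrictMono l) :
    sup (expo ω l) = List.ofFn l := by
  have h2 : (List.ofFn l).Pairwise (· < ·) := by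
    rw [List.pairwise_ofFn]; exact fun i j h => hl h
  refine List.Perm.eq_of_pairwise (le := (· < ·)) ?_ (sup_sorted _) h2 ?_
  · intro a b _ _ h1 h2; exact absurd h1 (not_lt_of_gt h2)
  · rw [List.perm_ext_iff_of_nodup]
    · intro x
      simp [sup, expo_ne]
    · exact (sup_sorted _).imp (fun h => ne_of_lt h)
    · exact h2.imp (fun h => ne_of_lt h)

lemma coeff_qsym (ω : List ℕ+) (e : Fin r →₀ ℕ) :
    coeff e (qsymMonomial r ω) = if comp e = ω.map (fun k : ℕ+ => (k : ℕ)) then 1 else 0 := by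
  rw [qsym_eq, coeff_sum]
  simp only [coeff_monomial]
  split_ifs with h
  · have hlen : (sup e).length = ω.length := by
      have := congrArg List.length h
      simpa [comp_eq] using this
    have hmono : StrictMono (fun i : Fin ω.length => (sup e).get (i.cast hlen.symm)) := by
      intro i j hij
      exact List.pairwise_iff_get.1 (sup_sorted e) _ _ hij
    rw [Finset.sum_eq_single (fun i : Fin ω.length => (sup e).get (i.cast hlen.symm)), if_pos]
    · ext x
      by_cases hx : ∃ i : Fin ω.length, (sup e).get (i.cast hlen.symm) = x
      · obtain ⟨i, rfl⟩ := hx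
        rw [expo_apply ω _ hmono i]
        have : (comp e)[(i : ℕ)]? = (ω.map (fun k : ℕ+ => (k : ℕ)))[(i : ℕ)]? := by rw [h]
        rw [comp_eq] at this
        simp [hlen] at this
        simp [this]
      · have h1 := hx
        rw [← expo_ne ω (fun i => (sup e).get (i.cast hlen.symm)), not_not] at h1
        rw [h1]
        by_contra h2
        apply hx
        have : x ∈ sup e := by simp [sup]; exact fun h => h2 h.symm
        obtain ⟨i, hi⟩ := List.mem_iff_get.1 this
        exact ⟨i.cast hlen, by simpa using hi⟩
    · intro l hl hne
      rw [if_neg]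
      rintro rfl
      simp only [Finset.mem_filter, Finset.mem_univ, true_and] at hl
      apply hne
      ext i
      simp [sup_expo ω l hl]
    · intro h1
      exact absurd (by simpa using hmono) h1
  · refine Finset.sum_eq_zero fun l hl => ?_
    rw [if_neg]
    rintro rfl
    simp only [Finset.mem_filter, Finset.mem_univ, true_and] at hl
    apply h
    rw [comp_eq, sup_expo ω l hl, List.map_ofFn]
    apply List.ext_getElem
    · simp
    · intro m h1 h2
      simp only [List.length_ofFn] at h1
      simp [expo_apply ω l hl]

/-! cancellation -/

lemma prod_two {M : Type*} [CommMonoid M] (q : ℕ) (hq : q + 1 < r) (G : Fin r → M) :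
    ∏ i, G i = G ⟨q, by omega⟩ * (G ⟨q + 1, hq⟩ *
      ∏ i ∈ (Finset.univ.erase (⟨q, by omega⟩ : Fin r)).erase ⟨q + 1, hq⟩, G i) := by
  rw [Finset.mul_prod_erase, Finset.mul_prod_erase]
  · simp
  · simp

lemma mem_rest {q : ℕ} {hq : q + 1 < r} {i : Fin r}
    (hi : i ∈ (Finset.univ.erase (⟨q, by omega⟩ : Fin r)).erase ⟨q + 1, hq⟩) :
    (i : ℕ) ≠ q ∧ (i : ℕ) ≠ q + 1 := by
  simp [Fin.ext_iff] at hi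
  tauto

lemma monomial_prod (e : Fin r →₀ ℕ) :
    (monomial e 1 : MvPolynomial (Fin r) ℚ) = ∏ i, X i ^ e i := by
  rw [MvPolynomial.monomial_eq, map_one, one_mul, Finsupp.prod_fintype]
  simp

lemma coeff_left (g : MvPolynomial (Fin r) ℚ) (q : ℕ) (hq : q + 1 < r) (f : Fin r →₀ ℕ) :
    coeff f (aeval (fun j : Fin r =>
      if (j : ℕ) = q then X (⟨q, by omega⟩ : Fin r)
      else if (j : ℕ) = q + 1 then -X (⟨q, by omega⟩ : Fin r)
      else (X j : MvPolynomial (Fin r) ℚ)) g) =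
    if f ⟨q + 1, hq⟩ = 0 then ∑ p ∈ Finset.HasAntidiagonal.antidiagonal (f ⟨q, by omega⟩),
      (-1 : ℚ) ^ p.2 * coeff (upd f q hq p.1 p.2) g else 0 := by
  induction g using MvPolynomial.induction_on' with
  | add p₁ p₂ h₁ h₂ =>
    rw [map_add, coeff_add, h₁, h₂]
    split_ifs
    · rw [← Finset.sum_add_distrib]
      refine Finset.sum_congr rfl fun p _ => ?_
      rw [coeff_add, mul_add]
    · simp
  | monomial e a =>
    have key : aeval (fun j : Fin r =>
      if (j : ℕ) = q then X (⟨q, by omega⟩ : Fin r)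
      else if (j : ℕ) = q + 1 then -X (⟨q, by omega⟩ : Fin r)
      else (X j : MvPolynomial (Fin r) ℚ)) (monomial e a) =
      monomial (upd e q hq (e ⟨q, by omega⟩ + e ⟨q + 1, hq⟩) 0) (a * (-1) ^ (e ⟨q + 1, hq⟩)) := by
      have e1 : ∏ i ∈ (Finset.univ.erase (⟨q, by omega⟩ : Fin r)).erase ⟨q + 1, hq⟩,
          (X i : MvPolynomial (Fin r) ℚ) ^ (upd e q hq (e ⟨q, by omega⟩ + e ⟨q + 1, hq⟩) 0 i) =
          ∏ i ∈ (Finset.univ.erase (⟨q, by omega⟩ : Fin r)).erase ⟨q + 1, hq⟩, X i ^ e i := by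
        refine Finset.prod_congr rfl fun i hi => ?_
        have := mem_rest hi
        simp [upd_apply, this]
      rw [← mul_one (a * (-1) ^ (e ⟨q + 1, hq⟩)), ← MvPolynomial.C_mul_monomial, monomial_prod,
        aeval_monomial, Finsupp.prod_fintype _ _ (by simp), prod_two q hq, prod_two q hq, e1,
        Finset.prod_congr rfl (g := fun i => X i ^ e i)]
      · simp only [upd_apply, MvPolynomial.algebraMap_eq]
        simp [neg_pow (X _ : MvPolynomial (Fin r) ℚ), pow_add]
        ring
      · intro i hi
        have := mem_rest hi
        simp [this]
    rw [key, coeff_monomial]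
    simp only [coeff_monomial]
    split_ifs with h1 h2 h2
    · subst h1
      rw [Finset.sum_eq_single (e ⟨q, by omega⟩, e ⟨q + 1, hq⟩), if_pos]
      · ring
      · ext x
        simp only [upd_apply]
        split_ifs with h3 h4
        · congr 1; ext; simp [h3]
        · congr 1; ext; simp [h4]
        · rfl
      · rintro ⟨i, j⟩ hp hne
        rw [if_neg, mul_zero]
        intro h
        apply hne
        rw [h]
        simp [upd_apply]
      · intro h
        simp [upd_apply] at h
    · subst h1
      simp [upd_apply] at h2
    · symm
      refine Finset.sum_eq_zero fun p hp => ?_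
      rw [if_neg, mul_zero]
      rintro rfl
      apply h1
      have := Finset.HasAntidiagonal.mem_antidiagonal.1 hp
      ext x
      simp only [upd_apply]
      simp only [Nat.add_eq_left, one_ne_zero, if_true, if_false]
      split_ifs with h3 h4
      · rw [this]; congr 1; ext; simp [h3]
      · rw [← h2]; congr 1; ext; simp [h4]
      · rfl
    · rfl

lemma coeff_right (g : MvPolynomial (Fin r) ℚ) (q : ℕ) (hq : q + 1 < r) (f : Fin r →₀ ℕ) :
    coeff f (aeval (fun j : Fin r =>
      if (j : ℕ) = q then (0 : MvPolynomial (Fin r) ℚ)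
      else if (j : ℕ) = q + 1 then 0
      else X j) g) =
    if f ⟨q, by omega⟩ = 0 ∧ f ⟨q + 1, hq⟩ = 0 then coeff f g else 0 := by
  induction g using MvPolynomial.induction_on' with
  | add p₁ p₂ h₁ h₂ =>
    rw [map_add, coeff_add, h₁, h₂]
    split_ifs <;> simp
  | monomial e a =>
    have key : aeval (fun j : Fin r =>
      if (j : ℕ) = q then (0 : MvPolynomial (Fin r) ℚ)
      else if (j : ℕ) = q + 1 then 0
      else X j) (monomial e a) =
      if e ⟨q, by omega⟩ = 0 ∧ e ⟨q + 1, hq⟩ = 0 then monomial e a else 0 := by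
      rw [← mul_one a, ← MvPolynomial.C_mul_monomial, monomial_prod, map_mul, map_prod,
        prod_two q hq, prod_two q hq,
        Finset.prod_congr rfl (g := fun i => X i ^ e i)]
      · split_ifs with h
        · simp [h]
        · rw [not_and_or] at h
          rcases h with h | h <;> simp [h]
      · intro i hi
        have := mem_rest hi
        simp [this]
    rw [key]
    by_cases h : e = f
    · subst h
      split_ifs <;> simp
    · split_ifs <;> simp [h]

lemma cancel_iff (g : MvPolynomial (Fin r) ℚ) (q : ℕ) (hq : q + 1 < r) :
    CancelRel g q hq ↔ ∀ f : Fin r →₀ ℕ, f ⟨q + 1, hq⟩ = 0 → 0 < f ⟨q, by omega⟩ →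
      ∑ p ∈ Finset.HasAntidiagonal.antidiagonal (f ⟨q, by omega⟩),
      (-1 : ℚ) ^ p.2 * coeff (upd f q hq p.1 p.2) g = 0 := by
  rw [CancelRel, MvPolynomial.ext_iff]
  refine forall_congr' fun f => ?_
  rw [coeff_left g q hq, coeff_right g q hq]
  by_cases h1 : f ⟨q + 1, hq⟩ = 0
  · rcases Nat.eq_zero_or_pos (f ⟨q, by omega⟩) with h2 | h2
    · have : upd f q hq 0 0 = f := by
        ext x
        simp only [upd_apply]
        split_ifs with h3 h4
        · rw [← h2]; congr 1; ext; simp [h3]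
        · rw [← h1]; congr 1; ext; simp [h4]
        · rfl
      simp [h1, h2, this]
    · simp [h1, h2, h2.ne']
  · simp [h1]

end PeakAlg

namespace PeakAlg

def V (n r : ℕ) : Submodule ℚ (MvPolynomial (Fin r) ℚ) where
  carrier := {g | g.IsHomogeneous n ∧ g ∈ Submodule.span ℚ (Set.range (qsymMonomial r)) ∧
          ∀ (q : ℕ) (hq : q + 1 < r), CancelRel g q hq}
  zero_mem' := ⟨isHomogeneous_zero _ _ _, Submodule.zero_mem _, fun q hq => by simp [CancelRel]⟩
  add_mem' := by
    rintro a b ⟨h1, h2, h3⟩ ⟨k1, k2, k3⟩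
    refine ⟨h1.add k1, Submodule.add_mem _ h2 k2, fun q hq => ?_⟩
    have e1 := h3 q hq
    have e2 := k3 q hq
    unfold CancelRel at *
    rw [map_add, map_add, e1, e2]
  smul_mem' := by
    rintro c a ⟨h1, h2, h3⟩
    refine ⟨(homogeneousSubmodule _ _ n).smul_mem c h1, Submodule.smul_mem _ c h2, fun q hq => ?_⟩
    have e1 := h3 q hq
    unfold CancelRel at *
    rw [map_smul, map_smul, e1]

lemma exists_coeff {r : ℕ} (g : MvPolynomial (Fin r) ℚ)
    (hg : g ∈ Submodule.span ℚ (Set.range (qsymMonomial r))) :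
    ∃ a : List ℕ → ℚ, ∀ e, coeff e g = a (comp e) := by
  induction hg using Submodule.span_induction with
  | mem x hx =>
    obtain ⟨ω, rfl⟩ := hx
    exact ⟨fun w => if w = ω.map (fun k : ℕ+ => (k : ℕ)) then 1 else 0, fun e => coeff_qsym ω e⟩
  | zero => exact ⟨0, fun e => by simp⟩
  | add x y _ _ hx hy =>
    obtain ⟨a, ha⟩ := hx
    obtain ⟨b, hb⟩ := hy
    exact ⟨a + b, fun e => by simp [ha, hb]⟩
  | smul c x _ hx =>
    obtain ⟨a, ha⟩ := hx
    exact ⟨c • a, fun e => by simp [ha]⟩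

lemma length_le_sum (w : List ℕ) (h : ∀ k ∈ w, 0 < k) : w.length ≤ w.sum := by
  induction w with
  | nil => simp
  | cons k l ih =>
    have h1 := h k (by simp)
    have h2 := ih (fun k hk => h k (by simp [hk]))
    simp; omega

lemma degree_w {r : ℕ} (e : Fin r →₀ ℕ) : e.degree = Finsupp.weight (1 : Fin r → ℕ) e :=
  DFunLike.congr_fun (Finsupp.degree_eq_weight_one (R := ℕ)) e

lemma upper {n r : ℕ} (hn : 1 ≤ n) (hr : n ≤ r) (g : MvPolynomial (Fin r) ℚ) (hg : g ∈ V n r)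
    (h0 : ∀ w ∈ oc n, coeff (pad r w) g = 0) : g = 0 := by
  obtain ⟨h1, h2, h3⟩ := hg
  obtain ⟨a, ha⟩ := exists_coeff g h2
  have main : ∀ (d : ℕ) (w : List ℕ), n - w.length = d → (∀ k ∈ w, 0 < k) → w.sum = n → a w = 0 := by
    intro d
    induction d using Nat.strong_induction_on with
    | _ d ih =>
    intro w hd hw hs
    have hl := length_le_sum w hw
    by_cases hodd : ∀ k ∈ w, Odd k
    · have hmem : w ∈ oc n := by
        rw [mem_oc]
        refine ⟨?_, hodd, hs⟩
        rintro rfl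
        simp at hs; omega
      have := h0 w hmem
      rw [ha, comp_pad w (by omega), filter_pos w hw] at this
      exact this
    · push Not at hodd
      obtain ⟨k, hk, hkodd⟩ := hodd
      rw [Nat.not_odd_iff_even] at hkodd
      have hkpos := hw k hk
      obtain ⟨α, β, rfl⟩ := List.append_of_mem hk
      have hα : ∀ x ∈ α, 0 < x := fun x hx => hw x (by simp [hx])
      have hβ : ∀ x ∈ β, 0 < x := fun x hx => hw x (by simp [hx])
      have lα := length_le_sum α hα
      have lβ := length_le_sum β hβ
      have k2 : 2 ≤ k := by
        obtain ⟨m, rfl⟩ := hkodd; omega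
      simp at hs
      have hq : α.length + 1 < r := by omega
      have hL : (α ++ k :: 0 :: β).length ≤ r := by simp; omega
      have rel := (cancel_iff g α.length hq).1 (h3 α.length hq) (pad r (α ++ k :: 0 :: β))
        (by simp [pad, List.getElem?_append]) (by simpa [pad, List.getElem?_append] using hkpos)
      have e1 : (pad r (α ++ k :: 0 :: β)) ⟨α.length, by omega⟩ = k := by
        simp [pad, List.getElem?_append]
      have e2 : ∀ i j, comp (upd (pad r (α ++ k :: 0 :: β)) α.length hq i j) =
          α ++ ([i, j].filter (fun k => decide (k ≠ 0)) ++ β) := by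
        intro i j
        rw [comp, ofFn_upd, ofFn_pad _ hL]
        have t1 : List.take α.length ((α ++ k :: 0 :: β) ++ List.replicate (r - (α ++ k :: 0 :: β).length) 0) = α := by
          simp
        have t2 : List.drop (α.length + 2) ((α ++ k :: 0 :: β) ++ List.replicate (r - (α ++ k :: 0 :: β).length) 0)
            = β ++ List.replicate (r - (α ++ k :: 0 :: β).length) 0 := by
          rw [← List.drop_drop]; simp
        rw [t1, t2, show i :: j :: (β ++ List.replicate (r - (α ++ k :: 0 :: β).length) 0) =
          [i, j] ++ (β ++ List.replicate (r - (α ++ k :: 0 :: β).length) 0) by rfl,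
          List.filter_append, List.filter_append, List.filter_append, filter_pos α hα, filter_pos β hβ]
        simp
      simp only [ha, e2, e1] at rel
      rw [sum_split k (by omega) (fun i j => (-1 : ℚ) ^ j * a (α ++ ([i, j].filter (fun k => decide (k ≠ 0)) ++ β))),
        Finset.sum_eq_zero] at rel
      · simp [hkpos.ne', hkodd.neg_one_pow] at rel
        linarith
      · intro j _
        have hj := j.2
        have f1 : [k - ((j : ℕ) + 1), (j : ℕ) + 1].filter (fun k => decide (k ≠ 0)) = [k - ((j : ℕ) + 1), (j : ℕ) + 1] := by
          apply filter_pos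
          intro x hx
          simp at hx
          omega
        rw [f1, ih _ _ _ rfl, mul_zero]
        · intro x hx
          simp at hx
          rcases hx with hx | rfl | rfl | hx
          · exact hα x hx
          · omega
          · omega
          · exact hβ x hx
        · simp; omega
        · simp at hd ⊢; omega
  ext e
  rw [coeff_zero]
  by_contra hne
  have hdeg : e.degree = n := by
    have := h1 hne
    rwa [← degree_w] at this
  apply hne
  rw [ha]
  exact main _ _ rfl (comp_pos e) (by rw [sum_comp, hdeg])

noncomputable def mk (n r : ℕ) (a : List ℕ → ℚ) : MvPolynomial (Fin r) ℚ :=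
  ∑ c : Composition n, a c.blocks • qsymMonomial r (c.blocks.map Nat.toPNat')

lemma coeff_mk (n r : ℕ) (a : List ℕ → ℚ) (e : Fin r →₀ ℕ) :
    coeff e (mk n r a) = if e.degree = n then a (comp e) else 0 := by
  have hb : ∀ c : Composition n, (c.blocks.map Nat.toPNat').map (fun k : ℕ+ => (k : ℕ)) = c.blocks := by
    intro c
    rw [List.map_map]
    conv_rhs => rw [← List.map_id c.blocks]
    refine List.map_congr_left fun k hk => ?_
    have := c.blocks_pos hk
    simp; omega
  rw [mk, coeff_sum]
  simp only [coeff_smul, coeff_qsym, hb, smul_eq_mul, mul_ite, mul_one, mul_zero]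
  split_ifs with h
  · rw [Finset.sum_eq_single (⟨comp e, fun {i} hi => comp_pos e i hi, by rw [sum_comp, h]⟩ : Composition n)]
    · simp
    · intro c _ hne
      rw [if_neg]
      intro h
      apply hne
      ext1
      exact h.symm
    · simp
  · refine Finset.sum_eq_zero fun c _ => ?_
    rw [if_neg]
    intro h2
    apply h
    rw [← sum_comp, h2, c.blocks_sum]

lemma prod_filter (w : List ℕ) :
    ((w.filter (fun k => decide (k ≠ 0))).map H).prod = (w.map H).prod := by
  induction w with
  | nil => rfl
  | cons k l ih =>
    by_cases h : k = 0
    · subst h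
      simpa [H_zero] using ih
    · rw [List.filter_cons_of_pos (by simp [h]), List.map_cons, List.map_cons, List.prod_cons,
        List.prod_cons, ih]

lemma mk_mem (n r : ℕ) (φ : A →ₗ[ℚ] ℚ) : mk n r (fun w => φ ((w.map H).prod)) ∈ V n r := by
  refine ⟨?_, ?_, ?_⟩
  · intro e he
    rw [coeff_mk] at he
    rw [← degree_w]
    by_contra h
    exact he (if_neg h)
  · exact Submodule.sum_mem _ fun c _ => Submodule.smul_mem _ _ (Submodule.subset_span ⟨_, rfl⟩)
  · intro q hq
    rw [cancel_iff]
    intro f h1 h2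
    simp only [coeff_mk]
    have hdeg : ∀ p ∈ Finset.HasAntidiagonal.antidiagonal (f ⟨q, by omega⟩),
        (upd f q hq p.1 p.2).degree = f.degree := by
      intro p hp
      have := Finset.HasAntidiagonal.mem_antidiagonal.1 hp
      have hf : f = upd f q hq (f ⟨q, by omega⟩) 0 := by
        ext x
        simp only [upd_apply]
        split_ifs with h3 h4
        · congr 1; ext; simp [h3]
        · rw [← h1]; congr 1; ext; simp [h4]
        · rfl
      conv_rhs => rw [hf]
      simp only [Finsupp.degree_eq_sum, ← List.sum_ofFn, ofFn_upd, List.sum_append, List.sum_cons]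
      omega
    have hstep : ∀ p ∈ Finset.HasAntidiagonal.antidiagonal (f ⟨q, by omega⟩),
        (-1 : ℚ) ^ p.2 * (if (upd f q hq p.1 p.2).degree = n then
          φ (((comp (upd f q hq p.1 p.2)).map H).prod) else 0) =
        if f.degree = n then φ ((((List.ofFn f).take q).map H).prod * ((-1 : A) ^ p.2 * (H p.1 * H p.2)) *
          (((List.ofFn f).drop (q + 2)).map H).prod) else 0 := by
      intro p hp
      rw [hdeg p hp]
      split_ifs
      · rw [comp, prod_filter, ofFn_upd]
        rcases neg_one_pow_eq_or ℚ p.2 with h | h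
        · have h' : (-1 : A) ^ p.2 = 1 := by
            rw [neg_one_pow_eq_one_iff_even (by norm_num)] at h
            exact h.neg_one_pow
          simp [h, h', mul_assoc]
        · have h' : (-1 : A) ^ p.2 = -1 := by
            rw [neg_one_pow_eq_neg_one_iff_odd (by norm_num)] at h
            exact h.neg_one_pow
          simp [h, h', mul_assoc]
      · simp
    rw [Finset.sum_congr rfl hstep]
    split_ifs
    · rw [← map_sum, ← Finset.sum_mul, ← Finset.mul_sum, H_rel _ h2]
      simp
    · simp

end PeakAlg

theorem statement1 (n r : ℕ) (hn : 1 ≤ n) (hr : n ≤ r) :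
    ∃ V : Submodule ℚ (MvPolynomial (Fin r) ℚ),
      (V : Set (MvPolynomial (Fin r) ℚ)) =
        {g | g.IsHomogeneous n ∧ g ∈ Submodule.span ℚ (Set.range (qsymMonomial r)) ∧
          ∀ (q : ℕ) (hq : q + 1 < r), CancelRel g q hq} ∧
      Module.finrank ℚ ↥V = Nat.fib n := by
  refine ⟨PeakAlg.V n r, rfl, ?_⟩
  let ρ : PeakAlg.V n r →ₗ[ℚ] (PeakAlg.oc n → ℚ) :=
    { toFun := fun g w => coeff (PeakAlg.pad r w.1) g.1
      map_add' := fun g h => by ext w; simp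
      map_smul' := fun c g => by ext w; simp }
  have hinj : Function.Injective ρ := by
    rw [injective_iff_map_eq_zero]
    intro g hg
    apply Subtype.ext
    exact PeakAlg.upper hn hr g.1 g.2 (fun w hw => congrFun hg ⟨w, hw⟩)
  have hsurj : Function.Surjective ρ := by
    intro y
    obtain ⟨φ, hφ⟩ := PeakAlg.exists_functional (PeakAlg.oc n) y
    refine ⟨⟨_, PeakAlg.mk_mem n r φ⟩, ?_⟩
    ext w
    change coeff (PeakAlg.pad r w.1) (PeakAlg.mk n r _) = y w
    obtain ⟨h1, h2, h3⟩ := (PeakAlg.mem_oc n w.1).1 w.2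
    have hpos : ∀ k ∈ w.1, 0 < k := fun k hk => (h2 k hk).pos
    have hlen := PeakAlg.length_le_sum w.1 hpos
    have hc : PeakAlg.comp (PeakAlg.pad r w.1) = w.1 := by
      rw [PeakAlg.comp_pad _ (by omega), PeakAlg.filter_pos _ hpos]
    rw [PeakAlg.coeff_mk, ← PeakAlg.sum_comp, hc, if_pos h3, ← hφ w]
    congr 2
    exact List.map_congr_left fun k hk => PeakAlg.H_odd (h2 k hk)
  rw [(LinearEquiv.ofBijective ρ ⟨hinj, hsurj⟩).finrank_eq, Module.finrank_fintype_fun_eq_card,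
    Fintype.card_coe, PeakAlg.card_oc]
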